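/- arXiv:1204.5251 — 3 statements merged into one kernel-verified Lean document; each statement's English description precedes it below -/
import Mathlib

section
/- Let q be a prime, let P be a finite set of primes with q ∉ P, and let A ⊆ M^c(q). Then d(q) ≤ 1 - ((q^q - q^{q-1})/(q^q - 1)) · (1/ζ(q)) · ∏_{p ∈ P} [ (1 - 1/p)/(1 - 1/p^q) · Σ_{a ∈ A} 1/p^a ], where ζ is the Riemann zeta function. -/
open Filter Topology

/-- `TowerMem q n` means that the prime `q` occurs somewhere in the tower
factorization of the positive integer `n`:  `1 ∉ M(q)`, and for `n ≥ 2`,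
`n ∈ M(q)` iff `q ∣ n` or some exponent in the prime factorization of `n`
lies in `M(q)`. -/
inductive TowerMem (q : ℕ) : ℕ → Prop
  | base (n : ℕ) (hn : 2 ≤ n) (hdvd : q ∣ n) : TowerMem q n
  | step (n p : ℕ) (hn : 2 ≤ n) (hp : p.Prime) (hdvd : p ∣ n)
      (hexp : TowerMem q (n.factorization p)) : TowerMem q n

open Classical in
/-- The proportion of the integers `{1, …, N}` that lie in `M(q)`. -/
noncomputable def towerRatio (q N : ℕ) : ℝ :=
  (((Finset.Icc 1 N).filter fun n => TowerMem q n).card : ℝ) / (N : ℝ)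

/-- The Riemann zeta function, given for real `s > 1` by `∑' n, n⁻ˢ`. -/
noncomputable def zetaReal (s : ℝ) : ℝ := ∑' n : ℕ, 1 / ((n : ℝ) + 1) ^ s

section Characterization

variable {q : ℕ}

lemma not_towerMem_of_lt_two {n : ℕ} (hn : n < 2) : ¬ TowerMem q n := by
  rintro (⟨_, h, _⟩ | ⟨_, _, h, _⟩) <;> omega

lemma not_towerMem_iff (hq : q.Prime) {n : ℕ} (hn : n ≠ 0) :
    ¬ TowerMem q n ↔ ¬ q ∣ n ∧ ∀ p, ¬ TowerMem q (n.factorization p) := by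
  constructor
  · intro h
    have h2 {p : ℕ} (hp : p.Prime) (hd : p ∣ n) : 2 ≤ n :=
      hp.two_le.trans (Nat.le_of_dvd (Nat.pos_of_ne_zero hn) hd)
    refine ⟨fun hd => h (.base n (h2 hq hd) hd), fun p hp => ?_⟩
    have hne : n.factorization p ≠ 0 := fun h0 =>
      not_towerMem_of_lt_two (by omega) (h0 ▸ hp)
    have hpp : p.Prime := by
      by_contra hc
      exact hne (Nat.factorization_eq_zero_of_not_prime _ hc)
    have hd : p ∣ n := Nat.dvd_of_factorization_pos hne
    exact h (.step n p (h2 hpp hd) hpp hd hp)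
  · rintro ⟨h1, h2⟩ (⟨_, _, h⟩ | ⟨_, p, _, _, _, h⟩)
    exacts [h1 h, h2 p h]

lemma not_towerMem_of_lt (hq : q.Prime) {n : ℕ} (hn : n < q) : ¬ TowerMem q n := by
  induction n using Nat.strong_induction_on with
  | _ n ih =>
    rcases eq_or_ne n 0 with rfl | h0
    · exact not_towerMem_of_lt_two (by omega)
    refine (not_towerMem_iff hq h0).2
      ⟨Nat.not_dvd_of_pos_of_lt (Nat.pos_of_ne_zero h0) hn, fun p => ?_⟩
    have h := Nat.factorization_lt p h0
    exact ih _ h (h.trans hn)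

lemma towerMem_prime_pow_iff (hq : q.Prime) {p : ℕ} (hp : p.Prime) (hpq : p ≠ q) (e : ℕ) :
    TowerMem q (p ^ e) ↔ TowerMem q e := by
  rw [← not_iff_not, not_towerMem_iff hq (pow_ne_zero _ hp.ne_zero)]
  constructor
  · intro h
    simpa [hp.factorization_pow] using h.2 p
  · intro h
    refine ⟨fun hd => hpq ((Nat.prime_dvd_prime_iff_eq hq hp).1 (hq.dvd_of_dvd_pow hd)).symm,
      fun r => ?_⟩
    rw [hp.factorization_pow]
    rcases eq_or_ne p r with rfl | hr
    · simpa using h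
    · rw [Finsupp.single_eq_of_ne hr.symm]
      exact not_towerMem_of_lt_two (by omega)

lemma not_towerMem_mul_iff (hq : q.Prime) {m n : ℕ} (hm : m ≠ 0) (hn : n ≠ 0)
    (h : m.Coprime n) : ¬ TowerMem q (m * n) ↔ ¬ TowerMem q m ∧ ¬ TowerMem q n := by
  rw [not_towerMem_iff hq (mul_ne_zero hm hn), not_towerMem_iff hq hm, not_towerMem_iff hq hn,
    hq.dvd_mul]
  have key (p : ℕ) : ¬ TowerMem q ((m * n).factorization p) ↔
      ¬ TowerMem q (m.factorization p) ∧ ¬ TowerMem q (n.factorization p) := by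
    rw [Nat.factorization_mul_apply_of_coprime h]
    have h0 : ¬ TowerMem q 0 := not_towerMem_of_lt_two (by omega)
    by_cases hpm : p ∣ m ∧ p.Prime
    · have : ¬ p ∣ n := fun hpn => hpm.2.one_lt.ne' (Nat.eq_one_of_dvd_coprimes h hpm.1 hpn)
      simp [Nat.factorization_eq_zero_of_not_dvd this, h0]
    · have : m.factorization p = 0 := by
        rw [Nat.factorization_eq_zero_iff]; tauto
      simp [this, h0]
  simp only [key, forall_and]
  tauto

end Characterization

open Classical in
/-- The indicator function of the complement of `M(q)`. -/
noncomputable def towerFree (q n : ℕ) : ℝ := if TowerMem q n then 0 else 1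

/-- The generating function of the complement of `M(q)`. -/
noncomputable def towerSeries (q : ℕ) (x : ℝ) : ℝ := ∑' e : ℕ, towerFree q e * x ^ e

/-- The local Euler factor of the indicator of the complement of `M(q)`, normalized by that of
the indicator of the `q`-th power free numbers. -/
noncomputable def normalizedFactor (q : ℕ) (x : ℝ) : ℝ :=
  (1 - x) / (1 - x ^ q) * towerSeries q x

section Local

variable {q : ℕ}

lemma towerFree_nonneg (n : ℕ) : 0 ≤ towerFree q n := by
  unfold towerFree; split_ifs <;> norm_num

lemma towerFree_le_one (n : ℕ) : towerFree q n ≤ 1 := by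
  unfold towerFree; split_ifs <;> norm_num

lemma towerFree_congr {m n : ℕ} (h : TowerMem q m ↔ TowerMem q n) :
    towerFree q m = towerFree q n := by
  classical exact if_congr h rfl rfl

lemma towerFree_mul (hq : q.Prime) {m n : ℕ} (hm : m ≠ 0) (hn : n ≠ 0) (h : m.Coprime n) :
    towerFree q (m * n) = towerFree q m * towerFree q n := by
  have := not_towerMem_mul_iff hq hm hn h
  unfold towerFree
  split_ifs <;> first | tauto | norm_num

lemma summable_towerSeries {x : ℝ} (h0 : 0 ≤ x) (h1 : x < 1) :
    Summable fun e : ℕ => towerFree q e * x ^ e :=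
  (summable_geometric_of_lt_one h0 h1).of_nonneg_of_le
    (fun e => mul_nonneg (towerFree_nonneg e) (pow_nonneg h0 e))
    (fun e => mul_le_of_le_one_left (pow_nonneg h0 e) (towerFree_le_one e))

lemma one_sub_div_one_sub_pow_nonneg {x : ℝ} (h0 : 0 ≤ x) (h1 : x < 1) :
    0 ≤ (1 - x) / (1 - x ^ q) :=
  div_nonneg (by linarith) (by linarith [pow_le_one₀ (n := q) h0 h1.le])

lemma normalizedFactor_nonneg {x : ℝ} (h0 : 0 ≤ x) (h1 : x < 1) : 0 ≤ normalizedFactor q x :=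
  mul_nonneg (one_sub_div_one_sub_pow_nonneg h0 h1)
    (tsum_nonneg fun e => mul_nonneg (towerFree_nonneg e) (pow_nonneg h0 e))

lemma one_le_normalizedFactor (hq : q.Prime) {x : ℝ} (h0 : 0 ≤ x) (h1 : x < 1) :
    1 ≤ normalizedFactor q x := by
  have hlt : x ^ q < 1 := pow_lt_one₀ h0 h1 hq.ne_zero
  have hsum : (1 - x ^ q) / (1 - x) ≤ towerSeries q x := by
    calc (1 - x ^ q) / (1 - x) = ∑ e ∈ Finset.range q, x ^ e := by
          rw [geom_sum_eq h1.ne, ← neg_div_neg_eq]; ring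
      _ = ∑ e ∈ Finset.range q, towerFree q e * x ^ e := by
          refine Finset.sum_congr rfl fun e he => ?_
          simp [towerFree, not_towerMem_of_lt hq (Finset.mem_range.1 he)]
      _ ≤ towerSeries q x := (summable_towerSeries h0 h1).sum_le_tsum _
          fun e _ => mul_nonneg (towerFree_nonneg e) (pow_nonneg h0 e)
  calc (1 : ℝ) = (1 - x) / (1 - x ^ q) * ((1 - x ^ q) / (1 - x)) := by
        have : 1 - x ≠ 0 := by linarith
        have : 1 - x ^ q ≠ 0 := by linarith
        field_simp
    _ ≤ _ := mul_le_mul_of_nonneg_left hsum (one_sub_div_one_sub_pow_nonneg h0 h1)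

lemma tendsto_towerSeries {α : Type*} {l : Filter α} {u : α → ℝ} {x : ℝ} (h1 : x < 1)
    (h0 : 0 ≤ x) (hu : Tendsto u l (𝓝 x)) (hb : ∀ᶠ t in l, 0 ≤ u t ∧ u t ≤ x) :
    Tendsto (fun t => towerSeries q (u t)) l (𝓝 (towerSeries q x)) := by
  refine tendsto_tsum_of_dominated_convergence (summable_geometric_of_lt_one h0 h1)
    (fun e => (hu.pow e).const_mul _) ?_
  filter_upwards [hb] with t ht e
  rw [Real.norm_of_nonneg (mul_nonneg (towerFree_nonneg e) (pow_nonneg ht.1 e))]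
  exact (mul_le_of_le_one_left (pow_nonneg ht.1 e) (towerFree_le_one e)).trans
    (pow_le_pow_left₀ ht.1 ht.2 e)

lemma tsum_subset_le_towerSeries {A : Set ℕ} (hA : A ⊆ {m | ¬ TowerMem q m}) {x : ℝ}
    (h0 : 0 ≤ x) (h1 : x < 1) : ∑' a : A, x ^ (a : ℕ) ≤ towerSeries q x := by
  rw [tsum_subtype A (fun a => x ^ a)]
  refine Summable.tsum_le_tsum (fun e => ?_)
    ((summable_geometric_of_lt_one h0 h1).indicator A) (summable_towerSeries h0 h1)
  by_cases he : e ∈ A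
  · simp [he, towerFree, show ¬ TowerMem q e from hA he]
  · simpa [he] using mul_nonneg (towerFree_nonneg e) (pow_nonneg h0 e)

end Local

section Euler

variable {q : ℕ} {s : ℝ}

lemma natCast_prime_rpow_neg_lt_one {p : ℕ} (hp : p.Prime) (hs : 0 < s) : (p : ℝ) ^ (-s) < 1 :=
  Real.rpow_lt_one_of_one_lt_of_neg (by exact_mod_cast hp.one_lt) (by linarith)

lemma summable_towerFree_mul_rpow (hs : 1 < s) :
    Summable fun n : ℕ => towerFree q n * (n : ℝ) ^ (-s) :=
  (Real.summable_nat_rpow.2 (by linarith)).of_nonneg_of_le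
    (fun n => mul_nonneg (towerFree_nonneg n) (by positivity))
    (fun n => mul_le_of_le_one_left (by positivity) (towerFree_le_one n))

lemma tendsto_prod_towerFree (hq : q.Prime) (hs : 1 < s) :
    Tendsto (fun n : ℕ => ∏ p ∈ Nat.primesBelow n,
        if p = q then 1 else towerSeries q ((p : ℝ) ^ (-s))) atTop
      (𝓝 (∑' n : ℕ, towerFree q n * (n : ℝ) ^ (-s))) := by
  have hs0 : -s ≠ 0 := by linarith
  have h1 : towerFree q 1 = 1 := by simp [towerFree, not_towerMem_of_lt_two]
  have hE := EulerProduct.eulerProduct (f := fun n : ℕ => towerFree q n * (n : ℝ) ^ (-s))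
    (by simp [h1]) ?_ (summable_towerFree_mul_rpow hs).norm (by simp [Real.zero_rpow hs0])
  · refine hE.congr fun n => Finset.prod_congr rfl fun p hp => ?_
    have hp := Nat.prime_of_mem_primesBelow hp
    have hpow (e : ℕ) : ((p ^ e : ℕ) : ℝ) ^ (-s) = ((p : ℝ) ^ (-s)) ^ e := by
      rw [Nat.cast_pow, ← Real.rpow_natCast_mul (by positivity), mul_comm,
        Real.rpow_mul_natCast (by positivity)]
    simp only [hpow]
    split_ifs with h
    · subst h
      rw [tsum_eq_single 0]
      · simp [h1]
      · intro e he
        have : TowerMem p (p ^ e) := .base _ (hp.two_le.trans (Nat.le_self_pow he p))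
          (dvd_pow_self p he)
        simp [towerFree, this]
    · exact tsum_congr fun e => by rw [towerFree_congr (towerMem_prime_pow_iff hq hp h e)]
  · intro m n h
    rcases eq_or_ne m 0 with rfl | hm
    · simp [Real.zero_rpow hs0]
    rcases eq_or_ne n 0 with rfl | hn
    · simp [Real.zero_rpow hs0]
    rw [towerFree_mul hq hm hn h, Nat.cast_mul, Real.mul_rpow (by positivity) (by positivity)]
    ring

lemma tendsto_prod_one_sub_rpow_inv (hs : 1 < s) :
    Tendsto (fun n : ℕ => ∏ p ∈ Nat.primesBelow n, (1 - (p : ℝ) ^ (-s))⁻¹) atTop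
      (𝓝 (∑' n : ℕ, (n : ℝ) ^ (-s))) := by
  let f : ℕ →*₀ ℝ :=
    { toFun := fun n => (n : ℝ) ^ (-s)
      map_zero' := by simp [Real.zero_rpow (show -s ≠ 0 by linarith)]
      map_one' := by simp
      map_mul' := fun m n => by
        rw [Nat.cast_mul, Real.mul_rpow (by positivity) (by positivity)] }
  exact EulerProduct.eulerProduct_completely_multiplicative (f := f)
    (Real.summable_nat_rpow.2 (by linarith)).norm

lemma prod_normalizedFactor_mul_tsum_le (hq : q.Prime) {P : Finset ℕ}
    (hP : ∀ p ∈ P, Nat.Prime p) (hqP : q ∉ P) (hs : 1 < s) :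
    ((1 - (q : ℝ) ^ (-s)) / (1 - ((q : ℝ) ^ (-s)) ^ q) *
        ∏ p ∈ P, normalizedFactor q ((p : ℝ) ^ (-s))) * ∑' n : ℕ, (n : ℝ) ^ (-s) ≤
      (∑' n : ℕ, towerFree q n * (n : ℝ) ^ (-s)) * ∑' n : ℕ, (n : ℝ) ^ (-(s * q)) := by
  have hsq : 1 < s * q := one_lt_mul_of_lt_of_le hs (by exact_mod_cast hq.one_le)
  refine le_of_tendsto_of_tendsto ((tendsto_prod_one_sub_rpow_inv hs).const_mul _)
    ((tendsto_prod_towerFree hq hs).mul (tendsto_prod_one_sub_rpow_inv hsq)) ?_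
  filter_upwards [eventually_gt_atTop ((insert q P).sup id)] with n hn
  have hx0 (p : ℕ) : 0 ≤ (p : ℝ) ^ (-s) := by positivity
  have hx1 {p : ℕ} (hp : p.Prime) : (p : ℝ) ^ (-s) < 1 :=
    natCast_prime_rpow_neg_lt_one hp (by linarith)
  have hprime : ∀ p ∈ insert q P, p.Prime := by
    simpa [hq] using hP
  have hsub : insert q P ⊆ Nat.primesBelow n := fun p hp =>
    Nat.mem_primesBelow.2 ⟨(Finset.le_sup (f := id) hp).trans_lt hn, hprime p hp⟩
  set g : ℕ → ℝ := fun p => (1 - (p : ℝ) ^ (-s)) / (1 - ((p : ℝ) ^ (-s)) ^ q) *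
    if p = q then 1 else towerSeries q ((p : ℝ) ^ (-s)) with hg
  have hgP : ∏ p ∈ insert q P, g p = (1 - (q : ℝ) ^ (-s)) / (1 - ((q : ℝ) ^ (-s)) ^ q) *
      ∏ p ∈ P, normalizedFactor q ((p : ℝ) ^ (-s)) := by
    rw [Finset.prod_insert hqP]
    congr 1
    · simp [hg]
    · refine Finset.prod_congr rfl fun p hp => ?_
      simp [hg, normalizedFactor, ne_of_mem_of_not_mem hp hqP]
  have hg0 : 0 ≤ ∏ p ∈ insert q P, g p := by
    rw [hgP]
    exact mul_nonneg (one_sub_div_one_sub_pow_nonneg (hx0 q) (hx1 hq))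
      (Finset.prod_nonneg fun p hp => normalizedFactor_nonneg (hx0 p) (hx1 (hP p hp)))
  have hle : ∏ p ∈ insert q P, g p ≤ ∏ p ∈ Nat.primesBelow n, g p := by
    rw [← Finset.prod_sdiff hsub]
    refine le_mul_of_one_le_left hg0 (Finset.one_le_prod fun p hp => ?_)
    obtain ⟨hpn, hpP⟩ := Finset.mem_sdiff.1 hp
    have hpq : p ≠ q := fun h => hpP (h ▸ Finset.mem_insert_self q P)
    simpa [hg, hpq, normalizedFactor] using one_le_normalizedFactor hq (hx0 p)
      (hx1 (Nat.prime_of_mem_primesBelow hpn))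
  have hinv : 0 ≤ ∏ p ∈ Nat.primesBelow n, (1 - (p : ℝ) ^ (-s))⁻¹ :=
    Finset.prod_nonneg fun p hp =>
      inv_nonneg.2 (by linarith [hx1 (Nat.prime_of_mem_primesBelow hp)])
  rw [← hgP]
  refine (mul_le_mul_of_nonneg_right hle hinv).trans_eq ?_
  rw [← Finset.prod_mul_distrib, ← Finset.prod_mul_distrib]
  refine Finset.prod_congr rfl fun p hp => ?_
  have hne : 1 - (p : ℝ) ^ (-s) ≠ 0 := by linarith [hx1 (Nat.prime_of_mem_primesBelow hp)]
  rw [show -(s * q) = -s * q by ring, Real.rpow_mul_natCast (by positivity)]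
  simp only [hg]
  field_simp

end Euler

section Density

variable {q : ℕ}

lemma tendsto_sub_one_mul_tsum_rpow {f : ℕ → ℝ} {l : ℝ} (h0 : ∀ n, 0 ≤ f n)
    (hf : Tendsto (fun n : ℕ => (∑ k ∈ Finset.Icc 1 n, f k) / (n : ℝ)) atTop (𝓝 l)) :
    Tendsto (fun s : ℝ => (s - 1) * ∑' n : ℕ, f n * (n : ℝ) ^ (-s)) (𝓝[>] 1) (𝓝 l) := by
  rw [← tendsto_ofReal_iff]
  refine (LSeries_tendsto_sub_mul_nhds_one_of_tendsto_sum_div_and_nonneg f hf h0).congr' ?_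
  filter_upwards [self_mem_nhdsWithin] with s hs
  have hs0 : s ≠ 0 := by linarith [Set.mem_Ioi.1 hs]
  push_cast
  congr 1
  refine tsum_congr fun n => ?_
  rw [LSeries.term_of_ne_zero' (by exact_mod_cast hs0), Complex.ofReal_cpow (by positivity)]
  push_cast
  rw [Complex.cpow_neg, div_eq_mul_inv]

lemma tendsto_sum_towerFree_div {d : ℝ} (hd : Tendsto (towerRatio q) atTop (𝓝 d)) :
    Tendsto (fun n : ℕ => (∑ k ∈ Finset.Icc 1 n, towerFree q k) / (n : ℝ)) atTop
      (𝓝 (1 - d)) := by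
  classical
  refine (hd.const_sub 1).congr' ?_
  filter_upwards [eventually_ne_atTop 0] with n hn
  have hfree (k : ℕ) : towerFree q k = 1 - if TowerMem q k then 1 else 0 := by
    unfold towerFree; split_ifs <;> norm_num
  have hn' : (n : ℝ) ≠ 0 := by exact_mod_cast hn
  simp only [hfree, Finset.sum_sub_distrib, Finset.sum_boole, towerRatio]
  simp [sub_div, hn']

lemma tsum_rpow_neg_natCast_eq_zetaReal (hq : 1 < q) :
    ∑' n : ℕ, (n : ℝ) ^ (-(q : ℝ)) = zetaReal q := by
  have hq' : (1 : ℝ) < q := by exact_mod_cast hq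
  rw [(Real.summable_nat_rpow.2 (by linarith)).tsum_eq_zero_add, zetaReal]
  rw [Nat.cast_zero, Real.zero_rpow (by linarith), zero_add]
  refine tsum_congr fun n => ?_
  rw [Real.rpow_neg (by positivity), one_div]
  push_cast
  rfl

lemma tsum_rpow_neg_antitone {a b : ℝ} (ha : 1 < a) (hab : a ≤ b) :
    ∑' n : ℕ, (n : ℝ) ^ (-b) ≤ ∑' n : ℕ, (n : ℝ) ^ (-a) := by
  refine Summable.tsum_le_tsum (fun n => ?_) (Real.summable_nat_rpow.2 (by linarith))
    (Real.summable_nat_rpow.2 (by linarith))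
  rcases Nat.eq_zero_or_pos n with rfl | hn
  · simp [Real.zero_rpow, show a ≠ 0 by linarith, show b ≠ 0 by linarith]
  · exact Real.rpow_le_rpow_of_exponent_le (by exact_mod_cast hn) (by linarith)

lemma zetaReal_pos (hq : 1 < q) : 0 < zetaReal q := by
  rw [← tsum_rpow_neg_natCast_eq_zetaReal hq]
  exact (Real.summable_nat_rpow.2 (by
    have : (1 : ℝ) < q := by exact_mod_cast hq
    linarith)).tsum_pos (fun n => by positivity) 1 (by simp)

lemma tendsto_natCast_prime_rpow_neg {p : ℕ} (hp : p.Prime) :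
    Tendsto (fun s : ℝ => (p : ℝ) ^ (-s)) (𝓝[>] 1) (𝓝 (1 / p)) := by
  have hp0 : (p : ℝ) ≠ 0 := by exact_mod_cast hp.ne_zero
  have h : Continuous fun s : ℝ => (p : ℝ) ^ (-s) :=
    continuous_const.rpow continuous_neg fun _ => .inl hp0
  simpa [Real.rpow_neg_one] using (h.tendsto 1).mono_left nhdsWithin_le_nhds

lemma one_div_prime_lt_one {p : ℕ} (hp : p.Prime) : 1 / (p : ℝ) < 1 := by
  rw [div_lt_one (by exact_mod_cast hp.pos)]
  exact_mod_cast hp.one_lt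

lemma tendsto_one_sub_div_one_sub_pow (hq : q ≠ 0) {p : ℕ} (hp : p.Prime) :
    Tendsto (fun s : ℝ => (1 - (p : ℝ) ^ (-s)) / (1 - ((p : ℝ) ^ (-s)) ^ q)) (𝓝[>] 1)
      (𝓝 ((1 - 1 / (p : ℝ)) / (1 - (1 / (p : ℝ)) ^ q))) := by
  have h := tendsto_natCast_prime_rpow_neg hp
  refine (h.const_sub 1).div ((h.pow q).const_sub 1) ?_
  linarith [pow_lt_one₀ (by positivity) (one_div_prime_lt_one hp) hq]

lemma tendsto_normalizedFactor (hq : q ≠ 0) {p : ℕ} (hp : p.Prime) :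
    Tendsto (fun s : ℝ => normalizedFactor q ((p : ℝ) ^ (-s))) (𝓝[>] 1)
      (𝓝 (normalizedFactor q (1 / p))) := by
  refine (tendsto_one_sub_div_one_sub_pow hq hp).mul (tendsto_towerSeries
    (one_div_prime_lt_one hp) (by positivity) (tendsto_natCast_prime_rpow_neg hp) ?_)
  filter_upwards [self_mem_nhdsWithin] with s hs
  refine ⟨by positivity, ?_⟩
  rw [one_div, ← Real.rpow_neg_one]
  exact Real.rpow_le_rpow_of_exponent_le (by exact_mod_cast hp.one_le)
    (neg_le_neg (Set.mem_Ioi.1 hs).le)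

lemma prod_normalizedFactor_le (hq : q.Prime) {P : Finset ℕ} (hP : ∀ p ∈ P, Nat.Prime p)
    (hqP : q ∉ P) {d : ℝ} (hd : Tendsto (towerRatio q) atTop (𝓝 d)) :
    (1 - 1 / (q : ℝ)) / (1 - (1 / (q : ℝ)) ^ q) * ∏ p ∈ P, normalizedFactor q (1 / p) ≤
      (1 - d) * zetaReal q := by
  have hl := ((tendsto_one_sub_div_one_sub_pow hq.ne_zero hq).mul
    (tendsto_finsetProd P fun p hp => tendsto_normalizedFactor hq.ne_zero (hP p hp))).mul
      tendsto_sub_mul_tsum_nat_rpow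
  have hr := (tendsto_sub_one_mul_tsum_rpow towerFree_nonneg
    (tendsto_sum_towerFree_div hd)).mul_const (zetaReal q)
  rw [mul_one] at hl
  refine le_of_tendsto_of_tendsto hl hr ?_
  filter_upwards [self_mem_nhdsWithin] with s hs
  have hs : 1 < s := hs
  have hz : ∑' n : ℕ, (n : ℝ) ^ (-(s * q)) ≤ zetaReal q := by
    rw [← tsum_rpow_neg_natCast_eq_zetaReal hq.one_lt]
    exact tsum_rpow_neg_antitone (by exact_mod_cast hq.one_lt)
      (le_mul_of_one_le_left (by positivity) hs.le)
  have h := (prod_normalizedFactor_mul_tsum_le hq hP hqP hs).trans (mul_le_mul_of_nonneg_left hz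
    (tsum_nonneg fun n => mul_nonneg (towerFree_nonneg n) (by positivity)))
  have h' := mul_le_mul_of_nonneg_left h (sub_nonneg.2 hs.le)
  have hrw : ∑' n : ℕ, 1 / (n : ℝ) ^ s = ∑' n : ℕ, (n : ℝ) ^ (-s) :=
    tsum_congr fun n => by rw [Real.rpow_neg (by positivity), one_div]
  rw [hrw]
  linarith

end Density

theorem tower_density_upper_bound_finite_zeta (q : ℕ) (hq : q.Prime)
    (P : Finset ℕ) (hP : ∀ p ∈ P, Nat.Prime p) (hqP : q ∉ P)
    (A : Set ℕ) (hA : A ⊆ {m | ¬ TowerMem q m})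
    (d : ℝ) (hd : Tendsto (towerRatio q) atTop (𝓝 d)) :
    d ≤ 1 - (((q : ℝ) ^ q - (q : ℝ) ^ (q - 1)) / ((q : ℝ) ^ q - 1)) *
      (1 / zetaReal q) *
      ∏ p ∈ P, ((1 - 1 / (p : ℝ)) / (1 - 1 / (p : ℝ) ^ q) *
        ∑' a : A, 1 / (p : ℝ) ^ (a : ℕ)) := by
  have hq1 : (1 : ℝ) < q := by exact_mod_cast hq.one_lt
  have hζ := zetaReal_pos hq.one_lt
  have hc : ((q : ℝ) ^ q - (q : ℝ) ^ (q - 1)) / ((q : ℝ) ^ q - 1) =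
      (1 - 1 / (q : ℝ)) / (1 - (1 / (q : ℝ)) ^ q) := by
    have hpow : (1 : ℝ) < (q : ℝ) ^ q := one_lt_pow₀ hq1 hq.ne_zero
    have h1 : (q : ℝ) ^ q - 1 ≠ 0 := by linarith
    have h2 : (q : ℝ) ^ (q - 1) = (q : ℝ) ^ q / q := by
      rw [pow_sub₀ _ (by linarith) hq.one_le, pow_one, div_eq_mul_inv]
    rw [h2, div_pow, one_pow]
    field_simp
  have hprod : ∏ p ∈ P, ((1 - 1 / (p : ℝ)) / (1 - 1 / (p : ℝ) ^ q) *
      ∑' a : A, 1 / (p : ℝ) ^ (a : ℕ)) ≤ ∏ p ∈ P, normalizedFactor q (1 / p) := by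
    simp only [← one_div_pow]
    refine Finset.prod_le_prod (fun p hp => ?_) fun p hp => ?_
    · exact mul_nonneg
        (one_sub_div_one_sub_pow_nonneg (by positivity) (one_div_prime_lt_one (hP p hp)))
        (tsum_nonneg fun a => by positivity)
    · exact mul_le_mul_of_nonneg_left
        (tsum_subset_le_towerSeries hA (by positivity) (one_div_prime_lt_one (hP p hp)))
        (one_sub_div_one_sub_pow_nonneg (by positivity) (one_div_prime_lt_one (hP p hp)))
  have hmain := prod_normalizedFactor_le hq hP hqP hd
  have hle := (mul_le_mul_of_nonneg_left hprod (one_sub_div_one_sub_pow_nonneg (q := q)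
    (by positivity) (one_div_prime_lt_one hq))).trans hmain
  rw [hc, mul_right_comm, mul_one_div, le_sub_comm, div_le_iff₀ hζ]
  exact hle
end

section
/- Let q be a prime, let P be a finite set of primes with q ∉ P, and let S ⊆ M(q) with q ∈ S. Then d(q) ≥ 1 - ((q^{q+1} - q^q)/(q^{q+1} - 1)) · (1/ζ(q+1)) · ∏_{p ∈ P} [ (1 - (1 - 1/p) · Σ_{s ∈ S} 1/p^s) / (1 - 1/p^{q+1}) ], where ζ is the Riemann zeta function. -/
open Filter Topology

open Classical in
/-- The number of `n ∈ {1, …, N}` satisfying `C`. -/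
noncomputable def countUpTo (C : ℕ → Prop) (N : ℕ) : ℕ :=
  ((Finset.Icc 1 N).filter C).card

/-- No exponent of a prime `p ∈ T` in `n` lies in the forbidden set `E p`. -/
def AvoidsExponents (E : ℕ → Finset ℕ) (T : Finset ℕ) (n : ℕ) : Prop :=
  ∀ p ∈ T, n.factorization p ∉ E p

lemma countUpTo_pow_dvd {C : ℕ → Prop} {p : ℕ} (hp : p.Prime)
    (hC : ∀ k n, n ≠ 0 → (C (p ^ k * n) ↔ C n)) (k N : ℕ) :
    countUpTo (fun n => C n ∧ p ^ k ∣ n) N = countUpTo C (N / p ^ k) := by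
  classical
  have hpos : 0 < p ^ k := pow_pos hp.pos k
  symm
  unfold countUpTo
  refine Finset.card_bij (fun m _ => p ^ k * m) ?_ ?_ ?_
  · intro m hm
    simp only [Finset.mem_filter, Finset.mem_Icc] at hm ⊢
    obtain ⟨⟨h1, h2⟩, h3⟩ := hm
    refine ⟨⟨Nat.mul_pos hpos h1, ?_⟩, (hC k m (by omega)).2 h3, dvd_mul_right _ _⟩
    rw [Nat.le_div_iff_mul_le hpos] at h2
    rwa [mul_comm]
  · intro a _ b _ hab
    exact Nat.eq_of_mul_eq_mul_left hpos hab
  · intro n hn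
    simp only [Finset.mem_filter, Finset.mem_Icc] at hn
    obtain ⟨⟨h1, h2⟩, h3, m, rfl⟩ := hn
    have hm : m ≠ 0 := by rintro rfl; simp at h1
    refine ⟨m, ?_, rfl⟩
    simp only [Finset.mem_filter, Finset.mem_Icc]
    refine ⟨⟨Nat.pos_of_ne_zero hm, ?_⟩, (hC k m hm).1 h3⟩
    rw [Nat.le_div_iff_mul_le hpos]
    rwa [mul_comm]

lemma countUpTo_factorization_eq {C : ℕ → Prop} {p : ℕ} (hp : p.Prime)
    (hC : ∀ k n, n ≠ 0 → (C (p ^ k * n) ↔ C n)) (s N : ℕ) :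
    countUpTo (fun n => C n ∧ n.factorization p = s) N + countUpTo C (N / p ^ (s + 1)) =
      countUpTo C (N / p ^ s) := by
  classical
  rw [← countUpTo_pow_dvd hp hC, ← countUpTo_pow_dvd hp hC]
  unfold countUpTo
  rw [← Finset.card_union_of_disjoint]
  · congr 1
    ext n
    simp only [Finset.mem_union, Finset.mem_filter, Finset.mem_Icc]
    by_cases hn : n = 0
    · simp [hn]
    · rw [hp.pow_dvd_iff_le_factorization hn, hp.pow_dvd_iff_le_factorization hn]
      constructor
      · rintro (⟨a, b, c⟩ | ⟨a, b, c⟩) <;> exact ⟨a, b, by omega⟩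
      · rintro ⟨a, b, c⟩
        rcases c.eq_or_lt with h | h
        · exact Or.inl ⟨a, b, h.symm⟩
        · exact Or.inr ⟨a, b, h⟩
  · rw [Finset.disjoint_left]
    intro n h1 h2
    simp only [Finset.mem_filter, Finset.mem_Icc] at h1 h2
    have := (hp.pow_dvd_iff_le_factorization (by omega : n ≠ 0)).1 h2.2.2
    omega

lemma countUpTo_factorization_notMem {C : ℕ → Prop} {p : ℕ} (hp : p.Prime)
    (hC : ∀ k n, n ≠ 0 → (C (p ^ k * n) ↔ C n)) (F : Finset ℕ) (N : ℕ) :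
    (countUpTo (fun n => n.factorization p ∉ F ∧ C n) N : ℝ) =
      countUpTo C N -
        ∑ s ∈ F, ((countUpTo C (N / p ^ s) : ℝ) - countUpTo C (N / p ^ (s + 1))) := by
  classical
  have hsum : ∑ s ∈ F, ((countUpTo C (N / p ^ s) : ℝ) - countUpTo C (N / p ^ (s + 1))) =
      ((((Finset.Icc 1 N).filter C).filter fun n => n.factorization p ∈ F).card : ℝ) := by
    rw [Finset.card_eq_sum_card_fiberwise (f := fun n => n.factorization p) (t := F)]
    · push_cast
      refine Finset.sum_congr rfl fun s hs => ?_
      rw [← countUpTo_factorization_eq hp hC s N]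
      push_cast
      rw [add_sub_cancel_right]
      unfold countUpTo
      congr 2
      ext n
      simp only [Finset.mem_filter]
      constructor
      · rintro ⟨a, b, c⟩
        exact ⟨⟨⟨a, b⟩, c ▸ hs⟩, c⟩
      · rintro ⟨⟨⟨a, b⟩, _⟩, c⟩
        exact ⟨a, b, c⟩
    · intro n hn
      exact (Finset.mem_filter.1 hn).2
  rw [hsum, eq_sub_iff_add_eq]
  unfold countUpTo
  have := Finset.card_filter_add_card_filter_not (s := (Finset.Icc 1 N).filter C)
    (fun n => n.factorization p ∈ F)
  rw [← this, Nat.cast_add, add_comm]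
  congr 3
  ext n
  simp only [Finset.mem_filter]
  tauto

lemma tendsto_countUpTo_div {C : ℕ → Prop} {δ : ℝ}
    (h : Tendsto (fun N : ℕ => (countUpTo C N : ℝ) / N) atTop (𝓝 δ)) {k : ℕ} (hk : 0 < k) :
    Tendsto (fun N : ℕ => (countUpTo C (N / k) : ℝ) / N) atTop (𝓝 (δ * (1 / k))) := by
  have h1 : Tendsto (fun N : ℕ => N / k) atTop atTop := Nat.tendsto_div_const_atTop hk.ne'
  have h2 : Tendsto (fun N : ℕ => ((N / k : ℕ) : ℝ) / N) atTop (𝓝 (1 / k)) := by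
    have := (tendsto_nat_floor_mul_div_atTop (R := ℝ) (a := 1 / k) (by positivity)).comp
      tendsto_natCast_atTop_atTop
    refine this.congr fun N => ?_
    simp only [Function.comp]
    rw [one_div, inv_mul_eq_div, Nat.floor_div_natCast, Nat.floor_natCast]
  refine ((h.comp h1).mul h2).congr' ?_
  filter_upwards [eventually_ge_atTop k] with N hN
  have : 0 < N / k := Nat.div_pos hN hk
  have h3 : ((N / k : ℕ) : ℝ) ≠ 0 := by exact_mod_cast this.ne'
  simp only [Function.comp]
  field_simp

/-- Integers whose exponents at finitely many primes avoid prescribed finite sets have the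
expected density. -/
lemma tendsto_countUpTo_avoidsExponents (E : ℕ → Finset ℕ) (T : Finset ℕ)
    (hT : ∀ p ∈ T, p.Prime) :
    Tendsto (fun N : ℕ => (countUpTo (AvoidsExponents E T) N : ℝ) / N) atTop
      (𝓝 (∏ p ∈ T, (1 - (1 - 1 / (p : ℝ)) * ∑ s ∈ E p, 1 / (p : ℝ) ^ s))) := by
  classical
  induction T using Finset.induction_on with
  | empty =>
    simp only [Finset.prod_empty]
    refine tendsto_const_nhds.congr' ?_
    filter_upwards [eventually_gt_atTop 0] with N hN
    have : (N : ℝ) ≠ 0 := by positivity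
    have hall : (Finset.Icc 1 N).filter (AvoidsExponents E ∅) = Finset.Icc 1 N :=
      Finset.filter_true_of_mem fun n _ r hr => absurd hr (Finset.notMem_empty r)
    rw [countUpTo, Finset.filter_congr_decidable, hall, Nat.card_Icc, Nat.add_sub_cancel,
      div_self this]
  | insert p T hpT ih =>
    have hp : p.Prime := hT p (Finset.mem_insert_self _ _)
    have hT' : ∀ r ∈ T, r.Prime := fun r hr => hT r (Finset.mem_insert_of_mem hr)
    have ih := ih hT'
    have hC : ∀ k n, n ≠ 0 → (AvoidsExponents E T (p ^ k * n) ↔ AvoidsExponents E T n) := by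
      intro k n hn
      refine forall₂_congr fun r hr => ?_
      have hrp : p ≠ r := by rintro rfl; exact hpT hr
      rw [Nat.factorization_mul (pow_ne_zero _ hp.ne_zero) hn, hp.factorization_pow]
      simp [hrp]
    have hins : AvoidsExponents E (insert p T) =
        fun n => n.factorization p ∉ E p ∧ AvoidsExponents E T n := by
      funext n
      simp [AvoidsExponents]
    rw [hins, Finset.prod_insert hpT]
    set δ := ∏ r ∈ T, (1 - (1 - 1 / (r : ℝ)) * ∑ s ∈ E r, 1 / (r : ℝ) ^ s)
    have hlim := ih.sub (tendsto_finsetSum (E p) fun s _ =>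
      (tendsto_countUpTo_div ih (pow_pos hp.pos s)).sub
        (tendsto_countUpTo_div ih (pow_pos hp.pos (s + 1))))
    have hval : δ - ∑ s ∈ E p, (δ * (1 / ((p ^ s : ℕ) : ℝ)) - δ * (1 / ((p ^ (s + 1) : ℕ) : ℝ))) =
        (1 - (1 - 1 / (p : ℝ)) * ∑ s ∈ E p, 1 / (p : ℝ) ^ s) * δ := by
      have hp0 : (p : ℝ) ≠ 0 := by exact_mod_cast hp.ne_zero
      rw [sub_mul, one_mul, Finset.mul_sum, Finset.sum_mul]
      congr 1
      refine Finset.sum_congr rfl fun s _ => ?_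
      push_cast
      field_simp
      ring
    rw [hval] at hlim
    refine hlim.congr fun N => ?_
    rw [countUpTo_factorization_notMem hp hC, sub_div, Finset.sum_div]
    simp only [sub_div]

lemma summable_one_div_prime_pow {p : ℕ} (hp : p.Prime) :
    Summable fun s : ℕ => 1 / (p : ℝ) ^ s := by
  have h := summable_geometric_of_lt_one (r := 1 / (p : ℝ)) (by positivity)
    (by rw [div_lt_one (by exact_mod_cast hp.pos)]; exact_mod_cast hp.one_lt)
  simpa [one_div] using h

lemma tsum_one_div_prime_pow {p : ℕ} (hp : p.Prime) :
    ∑' s : ℕ, 1 / (p : ℝ) ^ s = (1 - 1 / (p : ℝ))⁻¹ := by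
  have h := tsum_geometric_of_lt_one (r := 1 / (p : ℝ)) (by positivity)
    (by rw [div_lt_one (by exact_mod_cast hp.pos)]; exact_mod_cast hp.one_lt)
  simpa [one_div] using h

/-- The density of the integers whose exponent at `p` avoids `A`. -/
noncomputable def avoidDensity (A : Set ℕ) (p : ℕ) : ℝ :=
  1 - (1 - 1 / (p : ℝ)) * ∑' s : A, 1 / (p : ℝ) ^ (s : ℕ)

lemma one_sub_one_div_prime_pos {p : ℕ} (hp : p.Prime) : 0 < 1 - 1 / (p : ℝ) := by
  rw [sub_pos, div_lt_one (by exact_mod_cast hp.pos)]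
  exact_mod_cast hp.one_lt

lemma avoidDensity_nonneg (A : Set ℕ) {p : ℕ} (hp : p.Prime) : 0 ≤ avoidDensity A p := by
  have h1 := one_sub_one_div_prime_pos hp
  have h2 : ∑' s : A, 1 / (p : ℝ) ^ (s : ℕ) ≤ (1 - 1 / (p : ℝ))⁻¹ := by
    rw [← tsum_one_div_prime_pow hp]
    exact (summable_one_div_prime_pow hp).tsum_subtype_le _ A (fun s => by positivity)
  have h3 := mul_le_mul_of_nonneg_left h2 h1.le
  rw [mul_inv_cancel₀ h1.ne'] at h3
  unfold avoidDensity
  linarith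

lemma avoidDensity_singleton (q p : ℕ) :
    avoidDensity {q} p = 1 - (1 - 1 / (p : ℝ)) * (1 / (p : ℝ) ^ q) := by
  unfold avoidDensity
  rw [tsum_singleton q (fun s : ℕ => 1 / (p : ℝ) ^ s)]

lemma avoidDensity_ne_zero {q : ℕ} (hq : q.Prime) :
    avoidDensity {s | s ≠ 0} q = 1 - 1 / (q : ℝ) := by
  have h1 := one_sub_one_div_prime_pos hq
  have h2 := (summable_one_div_prime_pow hq).tsum_subtype_add_tsum_subtype_compl {0}
  rw [tsum_singleton 0 (fun s : ℕ => 1 / (q : ℝ) ^ s), tsum_one_div_prime_pow hq] at h2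
  have h3 : ∑' s : {s : ℕ | s ≠ 0}, 1 / (q : ℝ) ^ (s : ℕ) = (1 - 1 / (q : ℝ))⁻¹ - 1 := by
    rw [← h2]
    simp only [pow_zero, div_one, add_sub_cancel_left]
    rfl
  unfold avoidDensity
  rw [h3, mul_sub, mul_inv_cancel₀ h1.ne']
  ring

lemma tendsto_sum_filter_range_mem (A : Set ℕ) [DecidablePred (· ∈ A)] {p : ℕ} (hp : p.Prime) :
    Tendsto (fun k => ∑ s ∈ (Finset.range k).filter (· ∈ A), 1 / (p : ℝ) ^ s) atTop
      (𝓝 (∑' s : A, 1 / (p : ℝ) ^ (s : ℕ))) := by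
  rw [tsum_subtype A (fun s : ℕ => 1 / (p : ℝ) ^ s)]
  refine (((summable_one_div_prime_pow hp).indicator A).hasSum.tendsto_sum_nat).congr fun k => ?_
  rw [Finset.sum_filter]
  exact Finset.sum_congr rfl fun s _ => by simp [Set.indicator_apply]

lemma TowerMem.of_factorization {q n p : ℕ} (hn : n ≠ 0) (hp : p.Prime)
    (h : TowerMem q (n.factorization p)) : TowerMem q n := by
  have h2 : 2 ≤ n.factorization p := by cases h <;> assumption
  have hdvd : p ∣ n := Nat.dvd_of_factorization_pos (by omega)
  exact .step n p (hp.two_le.trans (Nat.le_of_dvd (Nat.pos_of_ne_zero hn) hdvd)) hp hdvd h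

lemma towerMem_of_dvd {q n : ℕ} (hq : q.Prime) (hn : n ≠ 0) (h : q ∣ n) : TowerMem q n :=
  .base n (hq.two_le.trans (Nat.le_of_dvd (Nat.pos_of_ne_zero hn) h)) h

lemma one_sub_towerRatio_le {q : ℕ} {C : ℕ → Prop} (hC : ∀ n, n ≠ 0 → ¬ TowerMem q n → C n)
    {N : ℕ} (hN : 0 < N) : 1 - towerRatio q N ≤ (countUpTo C N : ℝ) / N := by
  classical
  have hN' : (0 : ℝ) < N := by exact_mod_cast hN
  rw [sub_le_iff_le_add, towerRatio, ← add_div, le_div_iff₀ hN', one_mul]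
  have h1 := Finset.card_filter_add_card_filter_not (s := Finset.Icc 1 N) (fun n => TowerMem q n)
  have h2 : ((Finset.Icc 1 N).filter fun n => ¬ TowerMem q n).card ≤ countUpTo C N := by
    unfold countUpTo
    refine Finset.card_le_card fun n hn => ?_
    simp only [Finset.mem_filter, Finset.mem_Icc] at hn ⊢
    exact ⟨hn.1, hC n (by omega) hn.2⟩
  rw [Nat.card_Icc, Nat.add_sub_cancel] at h1
  have h3 : N ≤ countUpTo C N + ((Finset.Icc 1 N).filter fun n => TowerMem q n).card := by omega
  have h4 : (N : ℝ) ≤ ((countUpTo C N +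
    ((Finset.Icc 1 N).filter fun n => TowerMem q n).card : ℕ) : ℝ) := by exact_mod_cast h3
  push_cast at h4
  convert h4

lemma one_sub_le_prod_avoidDensity {q : ℕ} {d : ℝ}
    (hd : Tendsto (towerRatio q) atTop (𝓝 d)) (A : ℕ → Set ℕ)
    (hA : ∀ p n, p.Prime → n ≠ 0 → n.factorization p ∈ A p → TowerMem q n)
    (T : Finset ℕ) (hT : ∀ p ∈ T, p.Prime) :
    1 - d ≤ ∏ p ∈ T, avoidDensity (A p) p := by
  classical
  refine ge_of_tendsto' (tendsto_finsetProd T fun p hp =>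
    ((tendsto_sum_filter_range_mem (A p) (hT p hp)).const_mul _).const_sub _) fun k => ?_
  refine le_of_tendsto_of_tendsto (hd.const_sub 1)
    (tendsto_countUpTo_avoidsExponents (fun p => (Finset.range k).filter (· ∈ A p)) T hT) ?_
  filter_upwards [eventually_gt_atTop 0] with N hN
  refine one_sub_towerRatio_le (fun n hn h p hp hmem => h ?_) hN
  exact hA p n (hT p hp) hn (Finset.mem_filter.1 hmem).2

lemma tendsto_prod_primesBelow_zetaReal {q : ℕ} (hq : q ≠ 0) :
    Tendsto (fun n => ∏ p ∈ Nat.primesBelow n, (1 - 1 / (p : ℝ) ^ (q + 1))) atTop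
      (𝓝 (1 / zetaReal (q + 1))) := by
  let f : ℕ →*₀ ℝ :=
    { toFun := fun n => 1 / (n : ℝ) ^ (q + 1)
      map_zero' := by simp
      map_one' := by simp
      map_mul' := fun a b => by push_cast; rw [mul_pow]; field_simp }
  have hf : Summable f := Real.summable_one_div_nat_pow.2 (by omega)
  have hz : ∑' n, f n = zetaReal (q + 1) := by
    rw [hf.tsum_eq_zero_add, map_zero, zero_add, zetaReal]
    refine tsum_congr fun n => ?_
    change 1 / ((n + 1 : ℕ) : ℝ) ^ (q + 1) = _
    rw [← Real.rpow_natCast]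
    push_cast
    rfl
  have hpos : 0 < ∑' n, f n := hf.tsum_pos (fun n => by change 0 ≤ 1 / (n : ℝ) ^ (q + 1); positivity)
    1 (by simp)
  have h := (EulerProduct.eulerProduct_completely_multiplicative (f := f) hf.norm).inv₀ hpos.ne'
  rw [hz] at h
  rw [one_div]
  refine h.congr fun n => ?_
  rw [← Finset.prod_inv_distrib]
  exact Finset.prod_congr rfl fun p _ => inv_inv _

lemma one_sub_one_div_pow_pos {p : ℕ} (hp : p.Prime) (q : ℕ) :
    0 < 1 - 1 / (p : ℝ) ^ (q + 1) := by
  have : (1 : ℝ) < p := by exact_mod_cast hp.one_lt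
  rw [sub_pos, div_lt_one (by positivity)]
  exact one_lt_pow₀ this (by omega)

lemma avoidDensity_singleton_le {p : ℕ} (hp : p.Prime) (q : ℕ) :
    avoidDensity {q} p ≤ 1 - 1 / (p : ℝ) ^ (q + 1) := by
  have h2 : (2 : ℝ) ≤ p := by exact_mod_cast hp.two_le
  rw [avoidDensity_singleton]
  have h : (1 - 1 / (p : ℝ)) * (1 / (p : ℝ) ^ q) = ((p : ℝ) - 1) * (1 / (p : ℝ) ^ (q + 1)) := by
    field_simp
    ring
  rw [h]
  have h0 : 0 ≤ 1 / (p : ℝ) ^ (q + 1) := by positivity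
  nlinarith

theorem tower_density_lower_bound_finite_zeta (q : ℕ) (hq : q.Prime)
    (P : Finset ℕ) (hP : ∀ p ∈ P, Nat.Prime p) (hqP : q ∉ P)
    (S : Set ℕ) (hS : S ⊆ {m | TowerMem q m}) (hqS : q ∈ S)
    (d : ℝ) (hd : Tendsto (towerRatio q) atTop (𝓝 d)) :
    d ≥ 1 - (((q : ℝ) ^ (q + 1) - (q : ℝ) ^ q) / ((q : ℝ) ^ (q + 1) - 1)) *
      (1 / zetaReal (q + 1)) *
      ∏ p ∈ P, ((1 - (1 - 1 / (p : ℝ)) * ∑' s : S, 1 / (p : ℝ) ^ (s : ℕ)) /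
        (1 - 1 / (p : ℝ) ^ (q + 1))) := by
  classical
  let A : ℕ → Set ℕ := fun p => if p = q then {s | s ≠ 0} else if p ∈ P then S else {q}
  have hA : ∀ p n, p.Prime → n ≠ 0 → n.factorization p ∈ A p → TowerMem q n := by
    intro p n hp hn hmem
    simp only [A] at hmem
    split_ifs at hmem with h1 h2
    · subst h1
      exact towerMem_of_dvd hq hn (Nat.dvd_of_factorization_pos hmem)
    · exact .of_factorization hn hp (hS hmem)
    · exact .of_factorization hn hp (hS (hmem ▸ hqS))
  have hQ : ∀ p ∈ insert q P, p.Prime := Finset.forall_mem_insert _ _ _ |>.2 ⟨hq, hP⟩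
  let w : ℕ → ℝ := fun p => avoidDensity (A p) p / (1 - 1 / (p : ℝ) ^ (q + 1))
  have hw0 : ∀ p, p.Prime → 0 ≤ w p := fun p hp =>
    div_nonneg (avoidDensity_nonneg _ hp) (one_sub_one_div_pow_pos hp q).le
  have hbound : 1 - d ≤ (∏ p ∈ insert q P, w p) * (1 / zetaReal (q + 1)) := by
    refine ge_of_tendsto ((tendsto_prod_primesBelow_zetaReal hq.ne_zero).const_mul _) ?_
    filter_upwards [eventually_gt_atTop ((insert q P).sup id)] with n hn
    have hsub : insert q P ⊆ Nat.primesBelow n := fun p hp =>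
      Nat.mem_primesBelow.2 ⟨(Finset.le_sup (f := id) hp).trans_lt hn, hQ p hp⟩
    have hprime : ∀ p ∈ Nat.primesBelow n, p.Prime := fun p hp => Nat.prime_of_mem_primesBelow hp
    refine (one_sub_le_prod_avoidDensity hd A hA _ hprime).trans ?_
    have hfac : ∏ p ∈ Nat.primesBelow n, avoidDensity (A p) p =
        (∏ p ∈ Nat.primesBelow n, w p) *
          ∏ p ∈ Nat.primesBelow n, (1 - 1 / (p : ℝ) ^ (q + 1)) := by
      rw [← Finset.prod_mul_distrib]
      exact Finset.prod_congr rfl fun p hp =>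
        (div_mul_cancel₀ _ (one_sub_one_div_pow_pos (hprime p hp) q).ne').symm
    rw [hfac]
    refine mul_le_mul_of_nonneg_right ?_ (Finset.prod_nonneg fun p hp =>
      (one_sub_one_div_pow_pos (hprime p hp) q).le)
    rw [← Finset.prod_sdiff hsub]
    refine mul_le_of_le_one_left (Finset.prod_nonneg fun p hp => hw0 p (hQ p hp)) ?_
    refine Finset.prod_le_one (fun p hp => hw0 p (hprime p (Finset.mem_sdiff.1 hp).1)) ?_
    intro p hp
    obtain ⟨hp1, hp2⟩ := Finset.mem_sdiff.1 hp
    rw [Finset.mem_insert, not_or] at hp2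
    have hpp := hprime p hp1
    simp only [w, A, if_neg hp2.1, if_neg hp2.2]
    exact div_le_one_of_le₀ (avoidDensity_singleton_le hpp q) (one_sub_one_div_pow_pos hpp q).le
  rw [Finset.prod_insert hqP] at hbound
  have hwq : w q = ((q : ℝ) ^ (q + 1) - (q : ℝ) ^ q) / ((q : ℝ) ^ (q + 1) - 1) := by
    have hq0 : (q : ℝ) ≠ 0 := by exact_mod_cast hq.ne_zero
    have hden : (1 : ℝ) - 1 / (q : ℝ) ^ (q + 1) = ((q : ℝ) ^ (q + 1) - 1) / (q : ℝ) ^ (q + 1) := by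
      field_simp
    simp only [w, A, if_true, avoidDensity_ne_zero hq]
    rw [hden, div_div_eq_mul_div]
    congr 1
    field_simp
    ring
  have hwP : ∏ p ∈ P, w p =
      ∏ p ∈ P, ((1 - (1 - 1 / (p : ℝ)) * ∑' s : S, 1 / (p : ℝ) ^ (s : ℕ)) /
        (1 - 1 / (p : ℝ) ^ (q + 1))) := by
    refine Finset.prod_congr rfl fun p hp => ?_
    have hpq : p ≠ q := by rintro rfl; exact hqP hp
    have hAp : A p = S := by simp only [A, if_neg hpq, if_pos hp]
    simp only [w, hAp]
    rfl
  rw [hwq, hwP, mul_right_comm] at hbound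
  linarith
end

section
/- The sequence of densities d(q), indexed by primes q in increasing order, is strictly decreasing: if q < q' are primes then d(q') < d(q). -/
open Filter Topology

theorem TowerMem.le {q n : ℕ} (h : TowerMem q n) : q ≤ n := by
  induction h with
  | base n hn hdvd => exact Nat.le_of_dvd (by omega) hdvd
  | step n p hn hp hdvd hexp ih =>
    exact ih.trans (Nat.factorization_lt p (by omega)).le

theorem TowerMem.dvd_or_exists_prime_pow_dvd {q n : ℕ} (h : TowerMem q n) :
    q ∣ n ∨ ∃ p, p.Prime ∧ p ^ q ∣ n := by
  cases h with
  | base _ _ hdvd => exact Or.inl hdvd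
  | step _ p hn hp hdvd hexp =>
    exact Or.inr ⟨p, hp, (pow_dvd_pow p hexp.le).trans (Nat.ordProj_dvd n p)⟩

theorem card_multiples_Icc (N m : ℕ) : ((Finset.Icc 1 N).filter (m ∣ ·)).card = N / m :=
  Nat.Ioc_filter_dvd_card_eq_div N m

theorem le_towerRatio {q N : ℕ} (hq : 2 ≤ q) (hN : 0 < N) :
    1 / (q : ℝ) - 1 / (N : ℝ) ≤ towerRatio q N := by
  classical
  have hcard : N / q ≤ ((Finset.Icc 1 N).filter fun n => TowerMem q n).card := by
    rw [← card_multiples_Icc]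
    refine Finset.card_le_card fun n hn => ?_
    simp only [Finset.mem_filter, Finset.mem_Icc] at hn ⊢
    exact ⟨hn.1, .base n (hq.trans (Nat.le_of_dvd hn.1.1 hn.2)) hn.2⟩
  have hN' : (0 : ℝ) < N := by exact_mod_cast hN
  have hfloor : (N : ℝ) / q < ((N / q : ℕ) : ℝ) + 1 := by
    rw [← Nat.floor_div_eq_div (K := ℝ)]
    exact Nat.lt_floor_add_one _
  have hcard' : ((N / q : ℕ) : ℝ) ≤ ((Finset.Icc 1 N).filter fun n => TowerMem q n).card := by
    exact_mod_cast hcard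
  have hsplit : 1 / (q : ℝ) - 1 / (N : ℝ) = ((N : ℝ) / q - 1) / N := by
    field_simp
  rw [hsplit, towerRatio]
  gcongr
  refine (sub_le_iff_le_add.2 hfloor.le).trans ?_
  convert hcard'

theorem towerRatio_le {q N : ℕ} (hq : q.Prime) (hN : 0 < N) :
    towerRatio q N ≤ 1 / (q : ℝ) +
      ∑ p ∈ (Finset.Icc 2 N).filter (fun p => p.Prime ∧ p ≠ q), 1 / (p : ℝ) ^ q := by
  classical
  set A := (Finset.Icc 2 N).filter (fun p => p.Prime ∧ p ≠ q)
  have hsub : ((Finset.Icc 1 N).filter fun n => TowerMem q n) ⊆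
      (Finset.Icc 1 N).filter (q ∣ ·) ∪
        A.biUnion fun p => (Finset.Icc 1 N).filter (p ^ q ∣ ·) := by
    intro n hn
    simp only [Finset.mem_filter, Finset.mem_Icc, Finset.mem_union, Finset.mem_biUnion, A] at hn ⊢
    obtain ⟨hnN, hmem⟩ := hn
    by_cases hdvd : q ∣ n
    · exact Or.inl ⟨hnN, hdvd⟩
    obtain ⟨p, hp, hpn⟩ := hmem.dvd_or_exists_prime_pow_dvd.resolve_left hdvd
    have hpdvd : p ∣ n := (dvd_pow_self p hq.ne_zero).trans hpn
    refine Or.inr ⟨p, ⟨⟨hp.two_le, (Nat.le_of_dvd hnN.1 hpdvd).trans hnN.2⟩, hp, ?_⟩, hnN, hpn⟩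
    rintro rfl
    exact hdvd hpdvd
  have hcard : ((Finset.Icc 1 N).filter fun n => TowerMem q n).card ≤
      N / q + ∑ p ∈ A, N / p ^ q := by
    refine (Finset.card_le_card hsub).trans ((Finset.card_union_le _ _).trans ?_)
    rw [card_multiples_Icc]
    refine Nat.add_le_add_left (Finset.card_biUnion_le.trans (Finset.sum_le_sum fun p _ => ?_)) _
    rw [card_multiples_Icc]
  have hN' : (0 : ℝ) < N := by exact_mod_cast hN
  rw [towerRatio, div_le_iff₀ hN', add_mul, Finset.sum_mul]
  calc _ ≤ ((N / q + ∑ p ∈ A, N / p ^ q : ℕ) : ℝ) := by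
        convert (Nat.cast_le (α := ℝ)).2 hcard
    _ = ((N / q : ℕ) : ℝ) + ∑ p ∈ A, ((N / p ^ q : ℕ) : ℝ) := by push_cast; rfl
    _ ≤ _ := by
        gcongr with p hp
        · exact Nat.cast_div_le.trans_eq (by ring)
        · exact Nat.cast_div_le.trans_eq (by push_cast; ring)

theorem sum_Ico_one_div_cube_le {a : ℕ} (ha : 2 ≤ a) {b : ℕ} (hab : a ≤ b) :
    ∑ m ∈ Finset.Ico a b, 1 / (m : ℝ) ^ 3 ≤
      1 / (2 * (a : ℝ) * (a - 1)) - 1 / (2 * (b : ℝ) * (b - 1)) := by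
  induction b, hab using Nat.le_induction with
  | base => simp
  | succ b hab ih =>
    rw [Finset.sum_Ico_succ_top hab]
    have hb : (2 : ℝ) ≤ b := by exact_mod_cast ha.trans hab
    have hb1 : (0 : ℝ) < b - 1 := by linarith
    have key : 1 / (b : ℝ) ^ 3 ≤
        1 / (2 * b * (b - 1)) - 1 / (2 * ((b + 1 : ℕ) : ℝ) * (((b + 1 : ℕ) : ℝ) - 1)) := by
      have : 1 / (2 * (b : ℝ) * (b - 1)) - 1 / (2 * ((b + 1 : ℕ) : ℝ) * (((b + 1 : ℕ) : ℝ) - 1))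
          = 1 / ((b - 1) * b * (b + 1)) := by
        push_cast
        rw [add_sub_cancel_right]
        field_simp
        ring
      rw [this]
      apply one_div_le_one_div_of_le (by positivity)
      nlinarith
    linarith

theorem sum_one_div_pow_le {a n N : ℕ} (ha : 2 ≤ a) (hn : 3 ≤ n) {A : Finset ℕ}
    (hA : A ⊆ insert 2 (Finset.Ico a N)) :
    ∑ p ∈ A, 1 / (p : ℝ) ^ n ≤
      1 / 2 ^ n + 1 / (a : ℝ) ^ (n - 3) * (1 / (2 * (a : ℝ) * (a - 1))) := by
  have ha0 : (0 : ℝ) < a := by exact_mod_cast (by omega : 0 < a)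
  have ha1 : (1 : ℝ) < a := by exact_mod_cast (by omega : 1 < a)
  have htail : ∑ p ∈ Finset.Ico a N, 1 / (p : ℝ) ^ n ≤
      1 / (a : ℝ) ^ (n - 3) * (1 / (2 * (a : ℝ) * (a - 1))) := by
    have hcube : ∑ m ∈ Finset.Ico a N, 1 / (m : ℝ) ^ 3 ≤ 1 / (2 * (a : ℝ) * (a - 1)) := by
      have ha1' : (0 : ℝ) < a - 1 := by linarith
      rcases le_total a N with h | h
      · have hN : (0 : ℝ) ≤ N - 1 := by
          have : (a : ℝ) ≤ N := by exact_mod_cast h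
          linarith
        have : (0 : ℝ) ≤ 1 / (2 * (N : ℝ) * (N - 1)) := by positivity
        linarith [sum_Ico_one_div_cube_le ha h]
      · rw [Finset.Ico_eq_empty_of_le h, Finset.sum_empty]
        positivity
    refine le_trans ?_ (mul_le_mul_of_nonneg_left hcube (by positivity))
    rw [Finset.mul_sum]
    refine Finset.sum_le_sum fun m hm => ?_
    have ham : (a : ℝ) ≤ m := by exact_mod_cast (Finset.mem_Ico.1 hm).1
    have hm0 : (0 : ℝ) < m := ha0.trans_le ham
    rw [one_div_mul_one_div]
    apply one_div_le_one_div_of_le (by positivity)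
    calc (a : ℝ) ^ (n - 3) * (m : ℝ) ^ 3 ≤ (m : ℝ) ^ (n - 3) * (m : ℝ) ^ 3 := by gcongr
      _ = (m : ℝ) ^ n := by rw [← pow_add]; congr 1; omega
  calc ∑ p ∈ A, 1 / (p : ℝ) ^ n ≤ ∑ p ∈ insert 2 (Finset.Ico a N), 1 / (p : ℝ) ^ n :=
        Finset.sum_le_sum_of_subset_of_nonneg hA fun _ _ _ => by positivity
    _ ≤ 1 / 2 ^ n + ∑ p ∈ Finset.Ico a N, 1 / (p : ℝ) ^ n := by
        by_cases h : 2 ∈ Finset.Ico a N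
        · rw [Finset.insert_eq_of_mem h]
          exact le_add_of_nonneg_left (by positivity)
        · rw [Finset.sum_insert h]
          simp
    _ ≤ _ := by gcongr

theorem add_mul_add_le_mul_two_pow (k : ℕ) : (k + 5) * (k + 4) ≤ 20 * 2 ^ k := by
  induction k with
  | zero => norm_num
  | succ k ih => rw [pow_succ]; nlinarith

theorem one_div_add_lt_one_div_sub_one {n : ℕ} (hn : 5 ≤ n) :
    1 / (n : ℝ) + (1 / 2 ^ n + 1 / ((3 : ℕ) : ℝ) ^ (n - 3) *
      (1 / (2 * ((3 : ℕ) : ℝ) * (((3 : ℕ) : ℝ) - 1)))) < 1 / ((n : ℝ) - 1) := by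
  obtain ⟨k, rfl⟩ := Nat.exists_eq_add_of_le hn
  have hk : ((k : ℝ) + 5) * (k + 4) ≤ 20 * 2 ^ k := by
    exact_mod_cast add_mul_add_le_mul_two_pow k
  have hsub : 5 + k - 3 = k + 2 := by omega
  have hdiff : 1 / (((5 + k : ℕ) : ℝ) - 1) - 1 / ((5 + k : ℕ) : ℝ) =
      1 / (((k : ℝ) + 5) * (k + 4)) := by
    push_cast
    rw [show (5 : ℝ) + k - 1 = k + 4 by ring, show (5 : ℝ) + k = k + 5 by ring]
    field_simp
    ring
  have hle : 1 / (20 * 2 ^ k) ≤ 1 / (((k : ℝ) + 5) * (k + 4)) :=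
    one_div_le_one_div_of_le (by positivity) hk
  have hpow : 1 / (3 : ℝ) ^ k ≤ 1 / 2 ^ k :=
    one_div_le_one_div_of_le (by positivity) (by gcongr; norm_num)
  have h2 : 1 / (2 : ℝ) ^ (5 + k) = 1 / 32 * (1 / 2 ^ k) := by rw [pow_add]; field_simp; norm_num
  have h3 : 1 / (3 : ℝ) ^ (k + 2) = 1 / 9 * (1 / 3 ^ k) := by rw [pow_add]; field_simp; norm_num
  have h20 : 1 / (20 * (2 : ℝ) ^ k) = 1 / 20 * (1 / 2 ^ k) := by field_simp
  have hpos : (0 : ℝ) < 1 / 2 ^ k := by positivity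
  rw [hsub, h2]
  push_cast at hdiff ⊢
  rw [h3]
  linarith

theorem tower_density_strict_anti (q q' : ℕ) (hq : q.Prime) (hq' : q'.Prime)
    (hlt : q < q') (d d' : ℝ)
    (hd : Tendsto (towerRatio q) atTop (𝓝 d))
    (hd' : Tendsto (towerRatio q') atTop (𝓝 d')) :
    d' < d := by
  have hlower : 1 / (q : ℝ) ≤ d := by
    have hlim : Tendsto (fun N : ℕ => 1 / (q : ℝ) - 1 / (N : ℝ)) atTop (𝓝 (1 / (q : ℝ))) := by
      simpa using tendsto_const_nhds.sub (tendsto_one_div_atTop_nhds_zero_nat (𝕜 := ℝ))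
    refine le_of_tendsto_of_tendsto hlim hd ?_
    filter_upwards [eventually_gt_atTop 0] with N hN using le_towerRatio hq.two_le hN
  have hupper {a : ℕ} (ha : 2 ≤ a) (hprime : ∀ p, p.Prime → p ≠ q' → p ≠ 2 → a ≤ p) :
      d' ≤ 1 / (q' : ℝ) +
        (1 / 2 ^ q' + 1 / (a : ℝ) ^ (q' - 3) * (1 / (2 * (a : ℝ) * (a - 1)))) := by
    refine le_of_tendsto hd' ?_
    filter_upwards [eventually_gt_atTop 0] with N hN
    refine (towerRatio_le hq' hN).trans ?_
    gcongr
    refine sum_one_div_pow_le (N := N + 1) ha (by have := hq.two_le; omega) fun p hp => ?_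
    simp only [Finset.mem_filter, Finset.mem_Icc] at hp
    rw [Finset.mem_insert, Finset.mem_Ico]
    by_cases h2 : p = 2
    · exact Or.inl h2
    · exact Or.inr ⟨hprime p hp.2.1 hp.2.2 h2, by omega⟩
  have hq2 := hq.two_le
  rcases (by omega : q' = 3 ∨ q' = 4 ∨ 5 ≤ q') with rfl | rfl | h5
  · obtain rfl : q = 2 := by omega
    have := hupper (a := 5) (by norm_num) fun p hp h3 h2 => by
      by_contra! h
      interval_cases p <;> simp_all +decide
    norm_num at this hlower
    linarith
  · exact absurd hq' (by decide)
  · have h3 := hupper (a := 3) (by norm_num) fun p hp _ h2 => by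
      have := hp.two_le
      omega
    have hle : 1 / ((q' : ℝ) - 1) ≤ 1 / (q : ℝ) := by
      have hq0 : (0 : ℝ) < q := by exact_mod_cast hq.pos
      have : (q : ℝ) + 1 ≤ q' := by exact_mod_cast hlt
      exact one_div_le_one_div_of_le hq0 (by linarith)
    linarith [one_div_add_lt_one_div_sub_one h5]
end
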